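/- arXiv:2509.26381 — 5 statements merged into one kernel-verified Lean document; each statement's English description precedes it below -/
import Mathlib

section
/- Assume additionally that μ₀ := inf_k μ_k > 0. Then for every κ with 0 < κ < μ₀, the reactive capacitance has the convergent power-series expansion C(κ) = Σ_{n=1}^∞ (−1)^{n+1} c_n κⁿ, where c_n = (1/(2π)) Σ_{k=0}^∞ d_k²/μ_k^{n−1}; in particular the leading coefficient is c₁ = (1/(2π)) Σ_{k=0}^∞ d_k². -/
open Real Filter Topology

/-- For `0 < κ < μ₀ = inf_k μ_k`, the reactive capacitance has the convergent
power series `C(κ) = Σ_{n=1}^∞ (−1)^{n+1} c_n κⁿ`, with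
`c_n = (1/(2π)) Σ_k d_k²/μ_k^{n−1}`; in particular `c₁ = (1/(2π)) Σ_k d_k²`. -/
theorem stmt2 (μ d : ℕ → ℝ) (hμ : ∀ k, 0 < μ k)
    (hsum : Summable fun k => μ k * d k ^ 2) (hd : ∃ k, d k ≠ 0)
    (hμ0 : 0 < ⨅ k, μ k)
    (C : ℝ → ℝ)
    (hC : ∀ κ : ℝ, C κ = κ / (2 * π) * ∑' k, μ k * d k ^ 2 / (μ k + κ))
    (c : ℕ → ℝ)
    (hc : ∀ n : ℕ, 1 ≤ n → c n = 1 / (2 * π) * ∑' k, d k ^ 2 / μ k ^ (n - 1)) :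
    (∀ κ : ℝ, 0 < κ → κ < ⨅ k, μ k →
      HasSum (fun n : ℕ => (-1 : ℝ) ^ ((n + 1) + 1) * c (n + 1) * κ ^ (n + 1))
        (C κ)) ∧
    c 1 = 1 / (2 * π) * ∑' k, d k ^ 2 := by
  have hbdd : BddBelow (Set.range μ) := ⟨0, by rintro _ ⟨k, rfl⟩; exact (hμ k).le⟩
  have hle : ∀ k, (⨅ k, μ k) ≤ μ k := fun k => ciInf_le hbdd k
  set m := ⨅ k, μ k with hm
  have hd2 : Summable fun k => d k ^ 2 := by
    refine Summable.of_nonneg_of_le (fun k => sq_nonneg _) (fun k => ?_) (hsum.mul_left m⁻¹)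
    rw [← div_eq_inv_mul, le_div_iff₀ hμ0, mul_comm]
    exact mul_le_mul_of_nonneg_right (hle k) (sq_nonneg _)
  refine ⟨fun κ hκ hκm => ?_, ?_⟩
  · have hG : Summable fun p : ℕ × ℕ => d p.2 ^ 2 * (-κ / μ p.2) ^ p.1 := by
      have hr : Summable fun n : ℕ => (κ / m) ^ n :=
        summable_geometric_of_lt_one (by positivity) ((div_lt_one hμ0).2 hκm)
      have hB : Summable fun p : ℕ × ℕ => (κ / m) ^ p.1 * d p.2 ^ 2 :=
        hr.mul_of_nonneg hd2 (fun n => by positivity) (fun k => sq_nonneg _)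
      refine Summable.of_norm_bounded hB (fun p => ?_)
      have hp := hμ p.2
      rw [norm_mul, norm_pow, norm_pow, norm_div, norm_neg, Real.norm_of_nonneg hκ.le,
        Real.norm_of_nonneg hp.le, Real.norm_eq_abs, sq_abs, mul_comm]
      have := hle p.2
      gcongr
    have hfib : ∀ k, ∑' n : ℕ, d k ^ 2 * (-κ / μ k) ^ n = μ k * d k ^ 2 / (μ k + κ) := by
      intro k
      have hk := hμ k
      have hlt : ‖-κ / μ k‖ < 1 := by
        rw [norm_div, norm_neg, Real.norm_of_nonneg hκ.le, Real.norm_of_nonneg hk.le,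
          div_lt_one hk]
        exact hκm.trans_le (hle k)
      rw [tsum_mul_left, tsum_geometric_of_norm_lt_one hlt]
      have h1 : 1 - -κ / μ k = (μ k + κ) / μ k := by field_simp; ring
      rw [h1, inv_div]
      ring
    have hS : ∑' p : ℕ × ℕ, d p.2 ^ 2 * (-κ / μ p.2) ^ p.1
        = ∑' k, μ k * d k ^ 2 / (μ k + κ) := by
      have h2 : Summable fun p : ℕ × ℕ => d p.1 ^ 2 * (-κ / μ p.1) ^ p.2 := hG.prod_symm
      rw [← (Equiv.prodComm ℕ ℕ).tsum_eq]
      refine (h2.tsum_prod).trans ?_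
      exact tsum_congr hfib
    have h3 := (hG.hasSum.prod_fiberwise (fun n => (hG.prod_factor n).hasSum)).mul_left
      (κ / (2 * π))
    rw [hS, ← hC] at h3
    refine (congrArg (fun f : ℕ → ℝ => HasSum f (C κ)) (funext fun n => ?_)).mpr h3
    rw [hc (n + 1) (by omega)]
    have h4 : ∀ k, d k ^ 2 * (-κ / μ k) ^ n = (-κ) ^ n * (d k ^ 2 / μ k ^ n) := by
      intro k
      rw [div_pow]; ring
    simp only [h4, tsum_mul_left, Nat.add_sub_cancel]
    rw [neg_pow κ n]
    ring
  · rw [hc 1 le_rfl]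
    simp
end

section
/- Let a > 0 and let q : [0,a] → ℝ be continuous. Define G(ρ) = ∫₀^ρ η q(η) dη, C = 2G(a), and F(ρ) = (C/2)·log a − ∫_ρ^a G(s)/s ds for ρ ∈ (0,a]. Then −∫₀^a 2ρ q(ρ) F(ρ) dρ = −(C²/2)·log a + 2∫₀^a G(ρ)²/ρ dρ (all integrals converge absolutely, since G(ρ) = O(ρ²) as ρ → 0⁺). -/
open Real Filter Topology

theorem aux_deriv (a : ℝ) (f : ℝ → ℝ) (hf : ContinuousOn f (Set.Icc 0 a)) (x : ℝ)
    (hx : x ∈ Set.Ioo 0 a) : HasDerivAt (fun u => ∫ t in (0:ℝ)..u, f t) (f x) x := by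
  apply intervalIntegral.integral_hasDerivAt_right
  · apply ContinuousOn.intervalIntegrable
    rw [Set.uIcc_of_le hx.1.le]
    exact hf.mono (Set.Icc_subset_Icc_right hx.2.le)
  · exact (hf.mono Set.Ioo_subset_Icc_self).stronglyMeasurableAtFilter isOpen_Ioo x hx
  · exact hf.continuousAt (Icc_mem_nhds hx.1 hx.2)

theorem aux_cont (a : ℝ) (ha : 0 < a) (f : ℝ → ℝ) (hf : ContinuousOn f (Set.Icc 0 a)) :
    ContinuousOn (fun u => ∫ t in (0:ℝ)..u, f t) (Set.Icc 0 a) := by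
  have := intervalIntegral.continuousOn_primitive_interval (μ := MeasureTheory.volume)
    (f := f) (a := 0) (b := a) (by
      rw [Set.uIcc_of_le ha.le]
      exact hf.integrableOn_Icc)
  rwa [Set.uIcc_of_le ha.le] at this


/-- Integration-by-parts representation of the monopole coefficient:
for a continuous radial charge density `q` on `[0,a]`, with
`G(ρ) = ∫₀^ρ η q(η) dη`, `C = 2G(a)` and
`F(ρ) = (C/2) log a − ∫_ρ^a G(s)/s ds`, one has
`−∫₀^a 2ρ q(ρ) F(ρ) dρ = −(C²/2) log a + 2∫₀^a G(ρ)²/ρ dρ`. -/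
theorem stmt4 (a : ℝ) (ha : 0 < a) (q : ℝ → ℝ)
    (hq : ContinuousOn q (Set.Icc 0 a))
    (G : ℝ → ℝ) (hG : ∀ ρ : ℝ, G ρ = ∫ η in (0 : ℝ)..ρ, η * q η)
    (C : ℝ) (hC : C = 2 * G a)
    (F : ℝ → ℝ)
    (hF : ∀ ρ : ℝ, F ρ = C / 2 * Real.log a - ∫ s in ρ..a, G s / s) :
    -∫ ρ in (0 : ℝ)..a, 2 * ρ * q ρ * F ρ =
      -(C ^ 2 / 2) * Real.log a + 2 * ∫ ρ in (0 : ℝ)..a, G ρ ^ 2 / ρ := by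
  have hg : ContinuousOn (fun η => η * q η) (Set.Icc 0 a) := continuousOn_id.mul hq
  have hGe : G = fun ρ => ∫ η in (0 : ℝ)..ρ, η * q η := funext hG
  have hGc : ContinuousOn G (Set.Icc 0 a) := by rw [hGe]; exact aux_cont a ha _ hg
  have hGd : ∀ x ∈ Set.Ioo 0 a, HasDerivAt G (x * q x) x := by
    intro x hx; rw [hGe]; exact aux_deriv a _ hg x hx
  have hG0 : G 0 = 0 := by simp [hG]
  obtain ⟨M, hM⟩ := isCompact_Icc.exists_bound_of_continuousOn hq
  have hM0 : 0 ≤ M := (norm_nonneg _).trans (hM 0 ⟨le_rfl, ha.le⟩)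
  have hb : ∀ x ∈ Set.Icc 0 a, ‖G x / x‖ ≤ M * x := by
    intro x hx
    rcases hx.1.eq_or_lt with h | h
    · simp [← h]
    have h1 : ‖G x‖ ≤ (x * M) * |x - 0| := by
      rw [hG]
      apply intervalIntegral.norm_integral_le_of_norm_le_const
      intro t ht
      rw [Set.uIoc_of_le hx.1] at ht
      rw [norm_mul, Real.norm_of_nonneg ht.1.le]
      exact mul_le_mul ht.2 (hM t ⟨ht.1.le, ht.2.trans hx.2⟩) (norm_nonneg _) hx.1
    rw [norm_div, Real.norm_of_nonneg hx.1, div_le_iff₀ h]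
    rw [sub_zero, abs_of_pos h] at h1
    linarith
  have hH : ContinuousOn (fun s => G s / s) (Set.Icc 0 a) := by
    intro x hx
    rcases hx.1.eq_or_lt with h | h
    · subst h
      unfold ContinuousWithinAt
      simp only [div_zero]
      apply squeeze_zero_norm' (a := fun x => M * x)
      · filter_upwards [self_mem_nhdsWithin] with y hy using hb y hy
      · have : Tendsto (fun x : ℝ => M * x) (𝓝 0) (𝓝 (M * 0)) :=
          (continuous_const.mul continuous_id).tendsto 0
        rw [mul_zero] at this
        exact this.mono_left nhdsWithin_le_nhds
    · exact (hGc x hx).div continuousWithinAt_id h.ne'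
  have hHi : ∀ x ∈ Set.Icc 0 a, ∀ y ∈ Set.Icc 0 a,
      IntervalIntegrable (fun s => G s / s) MeasureTheory.volume x y := by
    intro x hx y hy
    exact (hH.mono (Set.uIcc_subset_Icc hx hy)).intervalIntegrable
  have h0 : (0:ℝ) ∈ Set.Icc 0 a := ⟨le_rfl, ha.le⟩
  have h1 : a ∈ Set.Icc 0 a := ⟨ha.le, le_rfl⟩
  set K : ℝ := C / 2 * Real.log a - ∫ s in (0:ℝ)..a, G s / s with hK
  have hFK : ∀ x ∈ Set.Icc 0 a, F x = K + ∫ s in (0:ℝ)..x, G s / s := by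
    intro x hx
    rw [hF, hK, ← intervalIntegral.integral_add_adjacent_intervals (hHi 0 h0 x hx) (hHi x hx a h1)]
    ring
  have hFc : ContinuousOn F (Set.Icc 0 a) :=
    (continuousOn_const.add (aux_cont a ha _ hH)).congr hFK
  have hFd : ∀ x ∈ Set.Ioo 0 a, HasDerivAt F (G x / x) x := by
    intro x hx
    refine ((aux_deriv a _ hH x hx).const_add K).congr_of_eventuallyEq ?_
    filter_upwards [Icc_mem_nhds hx.1 hx.2] with y hy using hFK y hy
  have hparts := intervalIntegral.integral_mul_deriv_eq_deriv_mul_of_hasDerivAt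
    (a := 0) (b := a) (u := F) (v := G) (u' := fun s => G s / s) (v' := fun s => s * q s)
    (by rwa [Set.uIcc_of_le ha.le]) (by rwa [Set.uIcc_of_le ha.le])
    (by rwa [min_eq_left ha.le, max_eq_right ha.le])
    (by rwa [min_eq_left ha.le, max_eq_right ha.le])
    (hHi 0 h0 a h1)
    (ContinuousOn.intervalIntegrable (by rwa [Set.uIcc_of_le ha.le]))
  have hFa : F a = C / 2 * Real.log a := by simp [hF]
  have e1 : ∫ ρ in (0 : ℝ)..a, 2 * ρ * q ρ * F ρ = 2 * ∫ ρ in (0 : ℝ)..a, F ρ * (ρ * q ρ) := by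
    rw [← intervalIntegral.integral_const_mul]
    congr 1; ext x; ring
  have e2 : ∫ ρ in (0 : ℝ)..a, G ρ ^ 2 / ρ = ∫ ρ in (0 : ℝ)..a, G ρ / ρ * G ρ := by
    congr 1; ext x; ring
  rw [e1, e2, hparts, hFa, hG0, hC]
  ring
end

section
/- Let a > 0, κ > 0, and take the constant charge density q(ρ) = κ/2 on [0,a]. With G(ρ) = ∫₀^ρ η q(η) dη = κρ²/4, C = 2G(a) = κa²/2, and F(ρ) = (C/2) log a − ∫_ρ^a G(s)/s ds = (κa²/4) log a − κ(a² − ρ²)/8, the monopole coefficient satisfies E = −∫₀^a 2ρ q(ρ) F(ρ) dρ = (κ²a⁴/8)(1/4 − log a). -/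
open Real Filter Topology

/-- Low-reactivity (constant charge density `q = κ/2`) evaluation of the
monopole coefficient: with `G(ρ) = κρ²/4`, `C = κa²/2`, and
`F(ρ) = (C/2) log a − ∫_ρ^a G(s)/s ds = (κa²/4) log a − κ(a²−ρ²)/8`,
one has `E = −∫₀^a 2ρ (κ/2) F(ρ) dρ = (κ²a⁴/8)(1/4 − log a)`. -/
theorem stmt6 (a κ : ℝ) (ha : 0 < a) (hκ : 0 < κ) :
    (∀ ρ : ℝ, ∫ η in (0 : ℝ)..ρ, η * (κ / 2) = κ * ρ ^ 2 / 4) ∧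
    2 * (κ * a ^ 2 / 4) = κ * a ^ 2 / 2 ∧
    (∀ ρ ∈ Set.Icc (0 : ℝ) a,
      (κ * a ^ 2 / 2) / 2 * Real.log a -
          ∫ s in ρ..a, (κ * s ^ 2 / 4) / s =
        κ * a ^ 2 / 4 * Real.log a - κ * (a ^ 2 - ρ ^ 2) / 8) ∧
    (-∫ ρ in (0 : ℝ)..a,
        2 * ρ * (κ / 2) *
          (κ * a ^ 2 / 4 * Real.log a - κ * (a ^ 2 - ρ ^ 2) / 8) =
      κ ^ 2 * a ^ 4 / 8 * (1 / 4 - Real.log a)) := by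
  refine ⟨?_, by ring, ?_, ?_⟩
  · intro ρ
    rw [intervalIntegral.integral_mul_const, integral_id]
    ring
  · intro ρ _
    have h : ∀ s : ℝ, (κ * s ^ 2 / 4) / s = s * (κ / 4) := by
      intro s
      rcases eq_or_ne s 0 with rfl | hs
      · simp
      · field_simp
    simp_rw [h]
    rw [intervalIntegral.integral_mul_const, integral_id]
    ring
  · have h : ∀ x ∈ Set.uIcc (0 : ℝ) a, HasDerivAt
        (fun x : ℝ => κ * (κ * a ^ 2 / 4 * Real.log a - κ * a ^ 2 / 8) / 2 * x ^ 2
          + κ ^ 2 / 32 * x ^ 4)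
        (2 * x * (κ / 2) * (κ * a ^ 2 / 4 * Real.log a - κ * (a ^ 2 - x ^ 2) / 8)) x := by
      intro x _
      refine HasDerivAt.congr_deriv (((hasDerivAt_pow 2 x).const_mul
        (κ * (κ * a ^ 2 / 4 * Real.log a - κ * a ^ 2 / 8) / 2)).add
        ((hasDerivAt_pow 4 x).const_mul (κ ^ 2 / 32))) ?_
      simp only [Nat.cast_ofNat, Nat.reduceSub, pow_one]
      ring
    rw [intervalIntegral.integral_eq_sub_of_hasDerivAt h
      (Continuous.intervalIntegrable (by fun_prop) _ _)]
    ring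
end

section
/- The Weber disk potential w is harmonic on the open upper half-space {y ∈ ℝ³ : y₃ > 0}, and it has the far-field decay ‖y‖ · w(y) → 2a/π as ‖y‖ → ∞ within the closed upper half-space; in particular the reactive capacitance of the perfectly absorbing disk is C(∞) = 2a/π. -/
open Real Filter Topology

/-- Partial derivative of `f` in the `i`-th coordinate direction. -/
noncomputable def pd (f : EuclideanSpace ℝ (Fin 3) → ℝ) (i : Fin 3)
    (x : EuclideanSpace ℝ (Fin 3)) : ℝ :=
  fderiv ℝ f x (EuclideanSpace.single i 1)

/-- The Euclidean Laplacian: sum of the three second partial derivatives. -/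
noncomputable def lap (f : EuclideanSpace ℝ (Fin 3) → ℝ)
    (x : EuclideanSpace ℝ (Fin 3)) : ℝ :=
  ∑ i : Fin 3, pd (pd f i) i x

/-- The auxiliary function `B(y₃,ρ₀) = ½(√((ρ₀+a)²+y₃²) + √((ρ₀−a)²+y₃²))`. -/
noncomputable def Bfun (a y3 ρ0 : ℝ) : ℝ :=
  (Real.sqrt ((ρ0 + a) ^ 2 + y3 ^ 2) + Real.sqrt ((ρ0 - a) ^ 2 + y3 ^ 2)) / 2

/-- The Weber disk potential `w(y) = (2/π) arcsin(a / B(y₃, ρ₀))`. -/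
noncomputable def weber (a : ℝ) (y : EuclideanSpace ℝ (Fin 3)) : ℝ :=
  2 / π * Real.arcsin (a / Bfun a (y 2) (Real.sqrt ((y 0) ^ 2 + (y 1) ^ 2)))


lemma le_of_sq_le_sq_aux {x y : ℝ} (hy : 0 ≤ y) (h : x ^ 2 ≤ y ^ 2) : x ≤ y :=
  le_of_abs_le (by simpa [abs_of_nonneg hy] using sq_le_sq.1 h)

abbrev E3 := EuclideanSpace ℝ (Fin 3)

noncomputable def Uf (a : ℝ) (y : E3) : ℝ := (y 0) ^ 2 + (y 1) ^ 2 + (y 2) ^ 2 - a ^ 2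
noncomputable def Sf (a : ℝ) (y : E3) : ℝ := √((Uf a y) ^ 2 + 4 * a ^ 2 * (y 2) ^ 2)
noncomputable def Lf (a : ℝ) (y : E3) : ℝ := √((Uf a y + Sf a y) / 2)
noncomputable def Bf (a : ℝ) (y : E3) : ℝ := Bfun a (y 2) (√((y 0) ^ 2 + (y 1) ^ 2))
noncomputable def pr (i : Fin 3) : E3 →L[ℝ] ℝ := EuclideanSpace.proj i

lemma pr_hasFDerivAt (i : Fin 3) (y : E3) : HasFDerivAt (fun y : E3 => y i) (pr i) y :=
  (pr i).hasFDerivAt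

lemma Sf_sq (a : ℝ) (y : E3) : Sf a y ^ 2 = (Uf a y) ^ 2 + 4 * a ^ 2 * (y 2) ^ 2 :=
  Real.sq_sqrt (by positivity)

lemma Sf_nonneg (a : ℝ) (y : E3) : 0 ≤ Sf a y := Real.sqrt_nonneg _

lemma Bf_nonneg (a : ℝ) (y : E3) : 0 ≤ Bf a y := by
  unfold Bf Bfun; positivity

lemma Bf_sq (a : ℝ) (y : E3) : 2 * Bf a y ^ 2 = Uf a y + 2 * a ^ 2 + Sf a y := by
  unfold Bf Bfun
  set ρ := √((y 0) ^ 2 + (y 1) ^ 2) with hρ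
  have h1 : ρ ^ 2 = (y 0) ^ 2 + (y 1) ^ 2 := Real.sq_sqrt (by positivity)
  have h2 : √((ρ + a) ^ 2 + (y 2) ^ 2) * √((ρ - a) ^ 2 + (y 2) ^ 2) = Sf a y := by
    rw [← Real.sqrt_mul (by positivity)]
    unfold Sf Uf
    congr 1
    rw [← h1]; ring
  have h3 := Real.sq_sqrt (show 0 ≤ (ρ + a) ^ 2 + (y 2) ^ 2 by positivity)
  have h4 := Real.sq_sqrt (show 0 ≤ (ρ - a) ^ 2 + (y 2) ^ 2 by positivity)
  have h5 : Uf a y = ρ ^ 2 + (y 2) ^ 2 - a ^ 2 := by rw [h1]; rfl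
  rw [h5]
  linear_combination h2 + h3 / 2 + h4 / 2

lemma norm_sq3 (y : E3) : ‖y‖ ^ 2 = (y 0) ^ 2 + (y 1) ^ 2 + (y 2) ^ 2 := by
  rw [EuclideanSpace.norm_sq_eq, Fin.sum_univ_three]; simp

lemma norm_le_Bf (a : ℝ) (y : E3) : ‖y‖ ≤ Bf a y := by
  refine le_of_sq_le_sq_aux (Bf_nonneg a y) ?_
  have h := Bf_sq a y
  have h1 : Uf a y = ‖y‖ ^ 2 - a ^ 2 := by rw [norm_sq3]; rfl
  have : Uf a y ≤ Sf a y := Real.le_sqrt_of_sq_le (by nlinarith [mul_nonneg (sq_nonneg a) (sq_nonneg (y 2))])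
  linarith

lemma Bf_le (a : ℝ) (ha : 0 < a) (y : E3) : Bf a y ≤ ‖y‖ + a := by
  refine le_of_sq_le_sq_aux (by positivity) ?_
  have h := Bf_sq a y
  have h1 : Uf a y = ‖y‖ ^ 2 - a ^ 2 := by rw [norm_sq3]; rfl
  have h3 : (y 2) ^ 2 ≤ ‖y‖ ^ 2 := by rw [norm_sq3]; nlinarith [sq_nonneg (y 0), sq_nonneg (y 1)]
  have : Sf a y ≤ ‖y‖ ^ 2 + a ^ 2 := by
    apply Real.sqrt_le_iff.2 ⟨by positivity, ?_⟩
    rw [h1]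
    nlinarith [mul_le_mul_of_nonneg_left h3 (sq_nonneg a)]
  nlinarith [mul_nonneg ha.le (norm_nonneg y)]

lemma weber_tendsto (a : ℝ) (ha : 0 < a) :
    Tendsto (fun y : E3 => ‖y‖ * weber a y) (comap (fun y : E3 => ‖y‖) atTop) (𝓝 (2 * a / π)) := by
  have hn : Tendsto (fun y : E3 => ‖y‖) (comap (fun y : E3 => ‖y‖) atTop) atTop := tendsto_comap
  have hB : Tendsto (Bf a) (comap (fun y : E3 => ‖y‖) atTop) atTop :=
    tendsto_atTop_mono (norm_le_Bf a) hn
  have hpos : ∀ᶠ y in comap (fun y : E3 => ‖y‖) atTop, 0 < ‖y‖ := hn.eventually_gt_atTop 0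
  have hu : Tendsto (fun y => a / Bf a y) (comap (fun y : E3 => ‖y‖) atTop) (𝓝[≠] 0) := by
    rw [tendsto_nhdsWithin_iff]
    refine ⟨hB.const_div_atTop a, ?_⟩
    filter_upwards [hpos] with y hy
    have := norm_le_Bf a y
    exact (div_pos ha (by linarith)).ne'
  have hd : HasDerivAt Real.arcsin 1 0 := by
    simpa using Real.hasDerivAt_arcsin (x := 0) (by norm_num) (by norm_num)
  have hs := (hasDerivAt_iff_tendsto_slope.1 hd).comp hu
  have hr : Tendsto (fun y => (Bf a y - ‖y‖) / Bf a y) (comap (fun y : E3 => ‖y‖) atTop) (𝓝 0) := by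
    refine squeeze_zero' ?_ ?_ (hB.const_div_atTop a)
    · filter_upwards with y
      exact div_nonneg (by linarith [norm_le_Bf a y]) (Bf_nonneg a y)
    · filter_upwards with y
      exact div_le_div_of_nonneg_right (by linarith [Bf_le a ha y]) (Bf_nonneg a y)
  have := ((tendsto_const_nhds (x := (1:ℝ))).sub hr).mul (hs.const_mul (2 / π * a))
  have e : (1 - 0) * (2 / π * a * 1) = 2 * a / π := by ring
  rw [e] at this
  refine this.congr' ?_
  filter_upwards [hpos] with y hy
  have hb : Bf a y ≠ 0 := by have := norm_le_Bf a y; linarith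
  simp only [Function.comp, slope_def_field, weber, Real.arcsin_zero, sub_zero]
  change _ = ‖y‖ * (2 / π * Real.arcsin (a / Bf a y))
  have := ha.ne'
  field_simp
  ring


lemma Sf_pos {a : ℝ} (ha : 0 < a) {y : E3} (hy : 0 < y 2) : 0 < Sf a y :=
  Real.sqrt_pos.2 (by positivity)

lemma US_pos {a : ℝ} (ha : 0 < a) {y : E3} (hy : 0 < y 2) : 0 < (Uf a y + Sf a y) / 2 := by
  have h1 := Sf_sq a y
  have h2 := Sf_pos ha hy
  have h3 : 0 < 4 * a ^ 2 * (y 2) ^ 2 := by positivity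
  by_contra h
  nlinarith

lemma Lf_pos {a : ℝ} (ha : 0 < a) {y : E3} (hy : 0 < y 2) : 0 < Lf a y :=
  Real.sqrt_pos.2 (US_pos ha hy)

lemma Lf_sq {a : ℝ} (ha : 0 < a) {y : E3} (hy : 0 < y 2) :
    Lf a y ^ 2 = (Uf a y + Sf a y) / 2 := Real.sq_sqrt (US_pos ha hy).le

lemma weber_eq {a : ℝ} (ha : 0 < a) {y : E3} (hy : 0 < y 2) :
    weber a y = 2 / π * Real.arctan (a / Lf a y) := by
  have hL := Lf_pos ha hy
  have hL2 := Lf_sq ha hy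
  have hB2 : Bf a y ^ 2 = Lf a y ^ 2 + a ^ 2 := by
    have := Bf_sq a y
    linarith
  have hB : 0 < Bf a y := by
    have h0 : Bf a y ≠ 0 := by
      intro h
      rw [h] at hB2
      nlinarith
    exact lt_of_le_of_ne (Bf_nonneg a y) h0.symm
  have hlt : a < Bf a y := by nlinarith
  change 2 / π * Real.arcsin (a / Bf a y) = _
  have hmem : a / Bf a y ∈ Set.Ioo (-1 : ℝ) 1 :=
    ⟨by linarith [div_pos ha hB], (div_lt_one hB).2 hlt⟩
  rw [Real.arcsin_eq_arctan hmem]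
  have : √(1 - (a / Bf a y) ^ 2) = Lf a y / Bf a y := by
    rw [Real.sqrt_eq_iff_mul_self_eq (by
      have : (a / Bf a y) ^ 2 ≤ 1 := by
        have h1 := hmem.1
        have h2 := hmem.2
        nlinarith
      linarith) (by positivity)]
    field_simp
    linarith
  rw [this]
  congr 2
  field_simp

lemma Uf_hasFDerivAt (a : ℝ) (y : E3) :
    HasFDerivAt (Uf a) ((2 * y 0) • pr 0 + (2 * y 1) • pr 1 + (2 * y 2) • pr 2) y := by
  have := ((((pr_hasFDerivAt 0 y).pow 2).add ((pr_hasFDerivAt 1 y).pow 2)).add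
    ((pr_hasFDerivAt 2 y).pow 2)).sub_const (a ^ 2)
  refine (this.congr_fderiv ?_)
  ext v
  simp

lemma Sf_hasFDerivAt {a : ℝ} (ha : 0 < a) {y : E3} (hy : 0 < y 2) :
    HasFDerivAt (Sf a) ((1 / Sf a y) • ((2 * y 0 * Uf a y) • pr 0 + (2 * y 1 * Uf a y) • pr 1
      + (2 * y 2 * (Uf a y + 2 * a ^ 2)) • pr 2)) y := by
  have hS := Sf_pos ha hy
  have := (((Uf_hasFDerivAt a y).pow 2).add
    (((pr_hasFDerivAt 2 y).pow 2).const_mul (4 * a ^ 2))).sqrt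
      (show _ ≠ 0 from (by positivity : 0 < (Uf a y) ^ 2 + 4 * a ^ 2 * (y 2) ^ 2).ne')
  refine (this.congr_fderiv ?_)
  ext v
  change (1 / (2 * Sf a y)) * _ = (1 / Sf a y) * _
  simp
  field_simp
  ring

lemma Lf_hasFDerivAt {a : ℝ} (ha : 0 < a) {y : E3} (hy : 0 < y 2) :
    HasFDerivAt (Lf a) ((1 / Sf a y) • ((y 0 * Lf a y) • pr 0 + (y 1 * Lf a y) • pr 1
      + (y 2 * (Lf a y ^ 2 + a ^ 2) / Lf a y) • pr 2)) y := by
  have hS := Sf_pos ha hy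
  have hL := Lf_pos ha hy
  have hL2 := Lf_sq ha hy
  have := (((Uf_hasFDerivAt a y).add (Sf_hasFDerivAt ha hy)).mul_const (2⁻¹)).sqrt
      (show _ ≠ 0 from (US_pos ha hy).ne')
  refine (this.congr_fderiv ?_)
  ext v
  change (1 / (2 * Lf a y)) * _ = (1 / Sf a y) * _
  have hU : Uf a y = 2 * Lf a y ^ 2 - Sf a y := by linarith
  simp [hU]
  field_simp
  ring

noncomputable def Gxy (a : ℝ) (i : Fin 3) (y : E3) : ℝ :=
  (-(2 * a / π)) * (y i * Lf a y * (Sf a y * (Lf a y ^ 2 + a ^ 2))⁻¹)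
noncomputable def Gz (a : ℝ) (y : E3) : ℝ :=
  (-(2 * a / π)) * (y 2 * (Sf a y * Lf a y)⁻¹)

lemma weber_hasFDerivAt {a : ℝ} (ha : 0 < a) {y : E3} (hy : 0 < y 2) :
    HasFDerivAt (weber a) (Gxy a 0 y • pr 0 + Gxy a 1 y • pr 1 + Gz a y • pr 2) y := by
  have hS := Sf_pos ha hy
  have hL := Lf_pos ha hy
  have hev : weber a =ᶠ[𝓝 y] fun y => 2 / π * Real.arctan (a * (Lf a y)⁻¹) := by
    have ho : IsOpen {y : E3 | 0 < y 2} := isOpen_lt continuous_const (by fun_prop)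
    filter_upwards [ho.mem_nhds hy] with z hz
    rw [weber_eq ha hz, div_eq_mul_inv a]
  refine HasFDerivAt.congr_of_eventuallyEq ?_ hev
  have hi := (hasDerivAt_inv hL.ne').comp_hasFDerivAt y (Lf_hasFDerivAt ha hy)
  have := ((hi.const_mul a).arctan).const_mul (2 / π)
  refine this.congr_fderiv ?_
  ext v
  simp [Gxy, Gz]
  field_simp

lemma pd_eq {f : E3 → ℝ} {y : E3} {c0 c1 c2 : ℝ}
    (h : HasFDerivAt f (c0 • pr 0 + c1 • pr 1 + c2 • pr 2) y) :
    pd f 0 y = c0 ∧ pd f 1 y = c1 ∧ pd f 2 y = c2 := by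
  unfold pd
  rw [h.fderiv]
  simp [pr]

lemma pd_congr {f g : E3 → ℝ} {y : E3} {i : Fin 3}
    (h : ∀ z : E3, 0 < z 2 → f z = g z) (hy : 0 < y 2) :
    pd f i y = pd g i y := by
  unfold pd
  have ho : IsOpen {y : E3 | 0 < y 2} := isOpen_lt continuous_const (by fun_prop)
  have : f =ᶠ[𝓝 y] g := by
    filter_upwards [ho.mem_nhds hy] with z hz using h z hz
  rw [this.fderiv_eq]

lemma Gxy_pd {a : ℝ} (ha : 0 < a) {y : E3} (hy : 0 < y 2) (i : Fin 3) (hi : i ≠ 2) :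
    pd (Gxy a i) i y = (-(2 * a / π)) * (
      (Lf a y + y i * (y i * Lf a y / Sf a y)) / (Sf a y * (Lf a y ^ 2 + a ^ 2))
      - y i * Lf a y * ((2 * y i * Uf a y / Sf a y) * (Lf a y ^ 2 + a ^ 2)
        + Sf a y * (2 * Lf a y * (y i * Lf a y / Sf a y))) / (Sf a y * (Lf a y ^ 2 + a ^ 2)) ^ 2) := by
  have hS := Sf_pos ha hy
  have hL := Lf_pos ha hy
  have hLd := Lf_hasFDerivAt ha hy
  have hD := (Sf_hasFDerivAt ha hy).mul ((hLd.pow 2).add_const (a ^ 2))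
  have hne : Sf a y * (Lf a y ^ 2 + a ^ 2) ≠ 0 := by positivity
  have hinv := (hasDerivAt_inv hne).comp_hasFDerivAt y hD
  have := (((pr_hasFDerivAt i y).mul hLd).mul hinv).const_mul (-(2 * a / π))
  unfold pd
  have e : fderiv ℝ (Gxy a i) y = _ := this.fderiv
  rw [e]
  fin_cases i
  · simp [pr]
    field_simp
    ring
  · simp [pr]
    field_simp
    ring
  · exact absurd rfl hi

lemma Gz_pd {a : ℝ} (ha : 0 < a) {y : E3} (hy : 0 < y 2) :
    pd (Gz a) 2 y = (-(2 * a / π)) * (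
      1 / (Sf a y * Lf a y)
      - y 2 * ((2 * y 2 * (Uf a y + 2 * a ^ 2) / Sf a y) * Lf a y
        + Sf a y * (y 2 * (Lf a y ^ 2 + a ^ 2) / Lf a y / Sf a y)) / (Sf a y * Lf a y) ^ 2) := by
  have hS := Sf_pos ha hy
  have hL := Lf_pos ha hy
  have hLd := Lf_hasFDerivAt ha hy
  have hD := (Sf_hasFDerivAt ha hy).mul hLd
  have hne : Sf a y * Lf a y ≠ 0 := by positivity
  have hinv := (hasDerivAt_inv hne).comp_hasFDerivAt y hD
  have := ((pr_hasFDerivAt 2 y).mul hinv).const_mul (-(2 * a / π))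
  unfold pd
  have e : fderiv ℝ (Gz a) y = _ := this.fderiv
  rw [e]
  simp [pr]
  field_simp
  ring

lemma alg (a L S U x y z : ℝ) (ha : 0 < a) (hL : 0 < L) (hS : 0 < S)
    (hU : U = x ^ 2 + y ^ 2 + z ^ 2 - a ^ 2)
    (hL2 : L ^ 2 = (U + S) / 2) (hS2 : S ^ 2 = U ^ 2 + 4 * a ^ 2 * z ^ 2) :
    ((L + x * (x * L / S)) / (S * (L ^ 2 + a ^ 2))
      - x * L * ((2 * x * U / S) * (L ^ 2 + a ^ 2)
        + S * (2 * L * (x * L / S))) / (S * (L ^ 2 + a ^ 2)) ^ 2)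
    + ((L + y * (y * L / S)) / (S * (L ^ 2 + a ^ 2))
      - y * L * ((2 * y * U / S) * (L ^ 2 + a ^ 2)
        + S * (2 * L * (y * L / S))) / (S * (L ^ 2 + a ^ 2)) ^ 2)
    + (1 / (S * L)
      - z * ((2 * z * (U + 2 * a ^ 2) / S) * L
        + S * (z * (L ^ 2 + a ^ 2) / L / S)) / (S * L) ^ 2) = 0 := by
  have hUL : U = 2 * L ^ 2 - S := by linarith
  have hz : a ^ 2 * z ^ 2 = L ^ 2 * (S - L ^ 2) := by
    rw [hUL] at hS2; linarith
  have hz2 : z ^ 2 = L ^ 2 * (S - L ^ 2) / a ^ 2 := by field_simp; linarith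
  have hx2 : x ^ 2 = 2 * L ^ 2 - S + a ^ 2 - L ^ 2 * (S - L ^ 2) / a ^ 2 - y ^ 2 := by
    rw [← hz2]; linarith
  have hq : L ^ 2 + a ^ 2 ≠ 0 := by positivity
  have expand : ((L + x * (x * L / S)) / (S * (L ^ 2 + a ^ 2))
      - x * L * ((2 * x * U / S) * (L ^ 2 + a ^ 2)
        + S * (2 * L * (x * L / S))) / (S * (L ^ 2 + a ^ 2)) ^ 2)
    + ((L + y * (y * L / S)) / (S * (L ^ 2 + a ^ 2))
      - y * L * ((2 * y * U / S) * (L ^ 2 + a ^ 2)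
        + S * (2 * L * (y * L / S))) / (S * (L ^ 2 + a ^ 2)) ^ 2)
    + (1 / (S * L)
      - z * ((2 * z * (U + 2 * a ^ 2) / S) * L
        + S * (z * (L ^ 2 + a ^ 2) / L / S)) / (S * L) ^ 2) =
    ((L + x ^ 2 * (L / S)) / (S * (L ^ 2 + a ^ 2))
      - x ^ 2 * L * ((2 * U / S) * (L ^ 2 + a ^ 2)
        + S * (2 * L * (L / S))) / (S * (L ^ 2 + a ^ 2)) ^ 2)
    + ((L + y ^ 2 * (L / S)) / (S * (L ^ 2 + a ^ 2))
      - y ^ 2 * L * ((2 * U / S) * (L ^ 2 + a ^ 2)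
        + S * (2 * L * (L / S))) / (S * (L ^ 2 + a ^ 2)) ^ 2)
    + (1 / (S * L)
      - z ^ 2 * ((2 * (U + 2 * a ^ 2) / S) * L
        + S * ((L ^ 2 + a ^ 2) / L / S)) / (S * L) ^ 2) := by ring
  rw [expand, hx2, hz2, hUL]
  field_simp
  ring

lemma Uf_contDiff (a : ℝ) : ContDiff ℝ 2 (Uf a) := by
  have h : ∀ i, ContDiff ℝ 2 (fun y : E3 => y i) := fun i => (pr i).contDiff
  exact ((((h 0).pow 2).add ((h 1).pow 2)).add ((h 2).pow 2)).sub contDiff_const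

lemma weber_contDiffOn {a : ℝ} (ha : 0 < a) :
    ContDiffOn ℝ 2 (weber a) {y : E3 | 0 < y 2} := by
  have h2 : ContDiff ℝ 2 (fun y : E3 => y 2) := (pr 2).contDiff
  have hU := Uf_contDiff a
  have hS : ContDiffOn ℝ 2 (Sf a) {y : E3 | 0 < y 2} := by
    refine ContDiffOn.sqrt ((hU.pow 2).add (contDiff_const.mul (h2.pow 2))).contDiffOn ?_
    intro y hy
    have hy' : 0 < y 2 := hy
    exact (by positivity : 0 < (Uf a y) ^ 2 + 4 * a ^ 2 * (y 2) ^ 2).ne'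
  have hL : ContDiffOn ℝ 2 (Lf a) {y : E3 | 0 < y 2} := by
    refine ContDiffOn.sqrt ((hU.contDiffOn.add hS).div_const 2) ?_
    intro y hy
    exact (US_pos ha hy).ne'
  have : ContDiffOn ℝ 2 (fun y => 2 / π * Real.arctan (a / Lf a y)) {y : E3 | 0 < y 2} :=
    contDiffOn_const.mul (Real.contDiff_arctan.comp_contDiffOn
      (contDiffOn_const.div hL (fun y hy => (Lf_pos ha hy).ne')))
  exact this.congr (fun y hy => weber_eq ha hy)

lemma weber_lap {a : ℝ} (ha : 0 < a) {y : E3} (hy : 0 < y 2) : lap (weber a) y = 0 := by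
  unfold lap
  rw [Fin.sum_univ_three]
  rw [pd_congr (g := Gxy a 0) (fun z hz => (pd_eq (weber_hasFDerivAt ha hz)).1) hy,
    pd_congr (g := Gxy a 1) (fun z hz => (pd_eq (weber_hasFDerivAt ha hz)).2.1) hy,
    pd_congr (g := Gz a) (fun z hz => (pd_eq (weber_hasFDerivAt ha hz)).2.2) hy,
    Gxy_pd ha hy 0 (by decide), Gxy_pd ha hy 1 (by decide), Gz_pd ha hy, ← mul_add, ← mul_add,
    alg a (Lf a y) (Sf a y) (Uf a y) (y 0) (y 1) (y 2) ha (Lf_pos ha hy) (Sf_pos ha hy) rfl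
      (Lf_sq ha hy) (Sf_sq a y), mul_zero]

/-- The Weber disk potential is harmonic on the open upper half-space and
has the far-field decay `‖y‖ w(y) → 2a/π` as `‖y‖ → ∞` within the closed
upper half-space: the reactive capacitance of the absorbing disk is `2a/π`. -/
theorem stmt7 (a : ℝ) (ha : 0 < a) :
    (ContDiffOn ℝ 2 (weber a) {y : EuclideanSpace ℝ (Fin 3) | 0 < y 2} ∧
      ∀ y : EuclideanSpace ℝ (Fin 3), 0 < y 2 → lap (weber a) y = 0) ∧
    Tendsto (fun y : EuclideanSpace ℝ (Fin 3) => ‖y‖ * weber a y)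
      (comap (fun y : EuclideanSpace ℝ (Fin 3) => ‖y‖) atTop ⊓
        Filter.principal {y : EuclideanSpace ℝ (Fin 3) | 0 ≤ y 2})
      (𝓝 (2 * a / π)) := by
  exact ⟨⟨weber_contDiffOn ha, fun y hy => weber_lap ha hy⟩,
    (weber_tendsto a ha).mono_left inf_le_left⟩
end

section
/- Let R > 0, a > 0, D > 0, κ > 0 (here κ denotes the surface reactivity 𝒦). Define Π(r) = 1 − (κR/D)/(1 + (κa/D)/(1 + a/R)) · (R/r − R/(R+a)) for r ∈ [R, R+a]. Then: (i) Π is a radially symmetric harmonic function, i.e. (d/dr)(r² Π'(r)) = 0 on (R, R+a); (ii) Π satisfies the Dirichlet condition Π(R+a) = 1; (iii) Π satisfies the Robin condition D Π'(R) = κ Π(R) at the inner sphere; and (iv) the escape probability from the reactive layer is Π(R) = (1 + (aκ/D)/(1 + a/R))^{−1}. -/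
open Real Filter Topology

/-- The splitting (escape) probability for the reactive spherical layer:
`Pi3(r) = 1 − (κR/D)/(1 + (κa/D)/(1+a/R)) (R/r − R/(R+a))` is radially
harmonic on `(R, R+a)`, satisfies the Dirichlet condition `Pi3(R+a) = 1`, the
Robin condition `D Pi3'(R) = κ Pi3(R)`, and the escape probability is
`Pi3(R) = (1 + (aκ/D)/(1+a/R))⁻¹`. -/
theorem stmt17 (R a D κ : ℝ) (hR : 0 < R) (ha : 0 < a) (hD : 0 < D)
    (hκ : 0 < κ)
    (Pi3 : ℝ → ℝ)
    (hPi3 : ∀ r : ℝ, Pi3 r =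
      1 - (κ * R / D) / (1 + (κ * a / D) / (1 + a / R)) *
        (R / r - R / (R + a))) :
    -- (i) radially symmetric harmonic: (r² Pi3'(r))' = 0 on (R, R+a)
    (∀ r ∈ Set.Ioo R (R + a), deriv (fun s : ℝ => s ^ 2 * deriv Pi3 s) r = 0) ∧
    -- (ii) Dirichlet condition at the outer sphere
    Pi3 (R + a) = 1 ∧
    -- (iii) Robin condition at the inner sphere
    D * deriv Pi3 R = κ * Pi3 R ∧
    -- (iv) escape probability from the reactive layer
    Pi3 R = (1 + (a * κ / D) / (1 + a / R))⁻¹ := by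
  have hRa : 0 < R + a := by positivity
  have hq : 0 < 1 + (κ * a / D) / (1 + a / R) := by positivity
  have hqe : (κ * a / D) / (1 + a / R) = κ * a * R / (D * (R + a)) := by
    field_simp
  have hder : ∀ C : ℝ, C = (κ * R / D) / (1 + (κ * a / D) / (1 + a / R)) →
      ∀ r : ℝ, r ≠ 0 → HasDerivAt Pi3 (C * R / r ^ 2) r := by
    intro C hC r hr
    have hf : Pi3 = fun r => 1 - C * (R * r⁻¹ - R / (R + a)) := by
      funext s
      rw [hPi3 s, hC, div_eq_mul_inv R s]
    rw [hf]
    have h := ((((hasDerivAt_inv hr).const_mul R).sub_const (R / (R + a))).const_mul C).const_sub 1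
    have e : C * R / r ^ 2 = -(C * (R * -(r ^ 2)⁻¹)) := by
      rw [div_eq_mul_inv]; ring
    rw [e]
    exact h
  have hPR : Pi3 R = (1 + (κ * a / D) / (1 + a / R))⁻¹ := by
    rw [hPi3 R, hqe]
    have h2 : D * (R + a) + κ * a * R ≠ 0 := by positivity
    have h3 : 1 + κ * a * R / (D * (R + a)) = (D * (R + a) + κ * a * R) / (D * (R + a)) := by
      field_simp
    rw [h3]
    field_simp
    ring
  refine ⟨?_, ?_, ?_, ?_⟩
  · intro r hr
    have hr0 : 0 < r := hR.trans hr.1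
    have he : (fun s : ℝ => s ^ 2 * deriv Pi3 s) =ᶠ[𝓝 r] fun _ =>
        (κ * R / D) / (1 + (κ * a / D) / (1 + a / R)) * R := by
      filter_upwards [lt_mem_nhds hr0] with s hs
      rw [(hder _ rfl s hs.ne').deriv]
      exact mul_div_cancel₀ _ (pow_ne_zero 2 hs.ne')
    rw [he.deriv_eq, deriv_const]
  · rw [hPi3]; simp
  · rw [(hder _ rfl R hR.ne').deriv, hPR]
    generalize 1 + (κ * a / D) / (1 + a / R) = q at hq
    field_simp
  · rw [hPR, mul_comm κ a]
end
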